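/- Let T = (T' ← T → T'') be a recollement of triangulated categories with functors (i^*, i_*, i^!) and (j_!, j^*, j_*). Then i^* admits a left adjoint F if and only if j_! admits a left adjoint; moreover, in this case F is fully faithful and (F(T'), j_!(T''), i_*(T')) is a TTF triple in T. -/

import Mathlib

open CategoryTheory Limits Pretriangulated

universe u₁ v₁ u₂ v₂ u₃ v₃

variable (T₁ : Type u₁) [Category.{v₁} T₁] [Preadditive T₁] [HasZeroObject T₁]
  [HasShift T₁ ℤ] [∀ n : ℤ, (shiftFunctor T₁ n).Additive] [Pretriangulated T₁]
variable (T₂ : Type u₂) [Category.{v₂} T₂] [Preadditive T₂] [HasZeroObject T₂]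
  [HasShift T₂ ℤ] [∀ n : ℤ, (shiftFunctor T₂ n).Additive] [Pretriangulated T₂]
variable (T₃ : Type u₃) [Category.{v₃} T₃] [Preadditive T₃] [HasZeroObject T₃]
  [HasShift T₃ ℤ] [∀ n : ℤ, (shiftFunctor T₃ n).Additive] [Pretriangulated T₃]

/-- A recollement of `T₂` in terms of `T₁` and `T₃` (`T₁ = T'`, `T₂ = T`, `T₃ = T''`). -/
structure Recollement where
  iStar : T₂ ⥤ T₁
  iIncl : T₁ ⥤ T₂
  iShriek : T₂ ⥤ T₁
  jShriek : T₃ ⥤ T₂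
  jStar : T₂ ⥤ T₃
  jLower : T₃ ⥤ T₂
  adj₁ : iStar ⊣ iIncl
  adj₂ : iIncl ⊣ iShriek
  adj₃ : jShriek ⊣ jStar
  adj₄ : jStar ⊣ jLower
  iFull : iIncl.Full
  iFaithful : iIncl.Faithful
  jShriekFull : jShriek.Full
  jShriekFaithful : jShriek.Faithful
  jLowerFull : jLower.Full
  jLowerFaithful : jLower.Faithful
  vanish : ∀ X : T₁, IsZero (jStar.obj (iIncl.obj X))
  tri₁ : ∀ X : T₂, ∃ δ : jLower.obj (jStar.obj X) ⟶ (iIncl.obj (iShriek.obj X))⟦(1 : ℤ)⟧,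
    Triangle.mk (adj₂.counit.app X) (adj₄.unit.app X) δ ∈ distTriang T₂
  tri₂ : ∀ X : T₂, ∃ δ : iIncl.obj (iStar.obj X) ⟶ (jShriek.obj (jStar.obj X))⟦(1 : ℤ)⟧,
    Triangle.mk (adj₃.counit.app X) (adj₁.unit.app X) δ ∈ distTriang T₂

variable {T₂}

/-- `T = X ⊥ Y`: no maps from `X` to `Y`, and every object of `T` is an extension of
an object of `X` by an object of `Y`. -/
def TorsionPair (X Y : T₂ → Prop) : Prop :=
  (∀ (A B : T₂) (f : A ⟶ B), X A → Y B → f = 0) ∧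
  ∀ Z : T₂, ∃ (A B : T₂) (_ : X A) (_ : Y B) (f : A ⟶ Z) (g : Z ⟶ B) (h : B ⟶ A⟦(1 : ℤ)⟧),
    Triangle.mk f g h ∈ distTriang T₂

/-- A TTF triple. -/
def TTFTriple (X Y Z : T₂ → Prop) : Prop := TorsionPair X Y ∧ TorsionPair Y Z

variable {T₁ T₃}

set_option linter.unusedSectionVars false

namespace CategoryTheory.Functor

/-- A functor `G` has a left adjoint as soon as every object admits a universal arrow to `G`. -/
lemma exists_leftAdjoint_of_universal_arrows {C D : Type*} [Category* C] [Category* D]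
    (G : D ⥤ C)
    (h : ∀ X : C, ∃ (K : D) (η : X ⟶ G.obj K),
      ∀ Y : D, Function.Bijective (fun f : K ⟶ Y => η ≫ G.map f)) :
    ∃ F : C ⥤ D, Nonempty (F ⊣ G) := by
  choose K η hη using h
  exact ⟨_, ⟨Adjunction.adjunctionOfEquivLeft (G := G)
    (fun X Y => Equiv.ofBijective _ (hη X Y)) (by simp)⟩⟩

lemma exists_retraction_of_mono_in_essImage {C D : Type*} [Category* C] [Preadditive C]
    [Category* D] [Preadditive D] [HasZeroObject D] [HasShift D ℤ]
    [∀ n : ℤ, (shiftFunctor D n).Additive] [Pretriangulated D]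
    (G : D ⥤ C) [G.Full] [G.Faithful] {X Y : C} (hX : G.essImage X) (hY : G.essImage Y)
    (f : X ⟶ Y) (hf : ∀ (W : C) (g : W ⟶ X), G.essImage W → g ≫ f = 0 → g = 0) :
    ∃ r : Y ⟶ X, f ≫ r = 𝟙 X := by
  obtain ⟨X', ⟨eX⟩⟩ := hX
  obtain ⟨Y', ⟨eY⟩⟩ := hY
  obtain ⟨φ, hφ⟩ := G.map_surjective (eX.hom ≫ f ≫ eY.inv)
  have : Mono φ := ⟨fun {W} a b hab => by
    apply G.map_injective
    have := congrArg (fun t => G.map t ≫ eY.hom) hab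
    simp only [G.map_comp, hφ, Category.assoc, Iso.inv_hom_id, Category.comp_id] at this
    have h0 := hf _ ((G.map a - G.map b) ≫ eX.hom) (G.obj_mem_essImage W)
      (by simp [Preadditive.sub_comp, this])
    rwa [← cancel_mono eX.hom, ← sub_eq_zero, ← Preadditive.sub_comp]⟩
  have := isSplitMono_of_mono φ
  refine ⟨eY.inv ≫ G.map (retraction φ) ≫ eX.hom, ?_⟩
  have hfφ : f ≫ eY.inv = eX.inv ≫ G.map φ := by simp [hφ]
  rw [reassoc_of% hfφ, ← G.map_comp_assoc]
  simp

lemma exists_section_of_epi_in_essImage {C D : Type*} [Category* C] [Preadditive C]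
    [Category* D] [Preadditive D] [HasZeroObject D] [HasShift D ℤ]
    [∀ n : ℤ, (shiftFunctor D n).Additive] [Pretriangulated D]
    (G : D ⥤ C) [G.Full] [G.Faithful] {X Y : C} (hX : G.essImage X) (hY : G.essImage Y)
    (f : X ⟶ Y) (hf : ∀ (W : C) (g : Y ⟶ W), G.essImage W → f ≫ g = 0 → g = 0) :
    ∃ s : Y ⟶ X, s ≫ f = 𝟙 Y := by
  obtain ⟨X', ⟨eX⟩⟩ := hX
  obtain ⟨Y', ⟨eY⟩⟩ := hY
  obtain ⟨φ, hφ⟩ := G.map_surjective (eX.hom ≫ f ≫ eY.inv)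
  have : Epi φ := ⟨fun {W} a b hab => by
    apply G.map_injective
    have := congrArg (fun t => eX.inv ≫ G.map t) hab
    simp only [G.map_comp, hφ, Category.assoc, Iso.inv_hom_id_assoc] at this
    have h0 := hf _ (eY.inv ≫ (G.map a - G.map b)) (G.obj_mem_essImage W)
      (by simp [Preadditive.comp_sub, this])
    rwa [← cancel_epi eY.inv, ← sub_eq_zero, ← Preadditive.comp_sub]⟩
  have := isSplitEpi_of_epi φ
  refine ⟨eY.inv ≫ G.map (section_ φ) ≫ eX.hom, ?_⟩
  have hfφ : eX.hom ≫ f = G.map φ ≫ eY.hom := by simp [hφ]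
  simp only [Category.assoc, hfφ]
  rw [← G.map_comp_assoc]
  simp

end CategoryTheory.Functor

namespace CategoryTheory.Pretriangulated

variable {A X B : T₂} {a : A ⟶ X} {b : X ⟶ B} {δ : B ⟶ A⟦(1 : ℤ)⟧}

lemma exists_desc_of_distTriang (hT : Triangle.mk a b δ ∈ distTriang T₂) {V : T₂} (f : X ⟶ V)
    (hf : a ≫ f = 0) : ∃ g : B ⟶ V, f = b ≫ g :=
  Triangle.yoneda_exact₂ _ hT f hf

lemma exists_lift_of_distTriang (hT : Triangle.mk a b δ ∈ distTriang T₂) {V : T₂} (f : V ⟶ X)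
    (hf : f ≫ b = 0) : ∃ g : V ⟶ A, f = g ≫ a :=
  Triangle.coyoneda_exact₂ _ hT f hf

lemma exists_extension_of_distTriang (hT : Triangle.mk a b δ ∈ distTriang T₂) {V : T₂}
    (f : A ⟶ V) (hf : δ ≫ f⟦(1 : ℤ)⟧' = 0) : ∃ g : X ⟶ V, f = a ≫ g := by
  have hT' : Triangle.mk δ (-a⟦(1 : ℤ)⟧') (-b⟦(1 : ℤ)⟧') ∈ distTriang T₂ :=
    rot_of_distTriang _ (rot_of_distTriang _ hT)
  obtain ⟨h, hh⟩ := exists_desc_of_distTriang hT' _ hf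
  obtain ⟨h, rfl⟩ := (shiftFunctor T₂ (1 : ℤ)).map_surjective h
  exact ⟨-h, (shiftFunctor T₂ (1 : ℤ)).map_injective (by simp [hh])⟩

lemma exists_rotate (hT : Triangle.mk a b δ ∈ distTriang T₂) :
    ∃ m : A⟦(1 : ℤ)⟧ ⟶ X⟦(1 : ℤ)⟧, Triangle.mk b δ m ∈ distTriang T₂ :=
  ⟨_, rot_of_distTriang _ hT⟩

lemma exists_invRotate (hT : Triangle.mk a b δ ∈ distTriang T₂) :
    ∃ (n : B⟦(-1 : ℤ)⟧ ⟶ A) (e : X ⟶ B⟦(-1 : ℤ)⟧⟦(1 : ℤ)⟧),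
      Triangle.mk n a e ∈ distTriang T₂ :=
  ⟨_, _, inv_rot_of_distTriang _ hT⟩

end CategoryTheory.Pretriangulated

namespace Recollement

variable (R : Recollement T₁ T₂ T₃)

attribute [instance] iFull iFaithful jShriekFull jShriekFaithful jLowerFull jLowerFaithful

lemma hom_jShriek_iIncl {A B : T₂} (f : A ⟶ B) (hA : R.jShriek.essImage A)
    (hB : R.iIncl.essImage B) : f = 0 := by
  obtain ⟨D, ⟨eA⟩⟩ := hA
  obtain ⟨Y, ⟨eB⟩⟩ := hB
  have : eA.hom ≫ f ≫ eB.inv = 0 :=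
    (R.adj₃.homEquiv _ _).injective ((R.vanish Y).eq_of_tgt _ _)
  simpa using eA.inv ≫= (this =≫ eB.hom)

lemma hom_iIncl_jLower {A B : T₂} (f : A ⟶ B) (hA : R.iIncl.essImage A)
    (hB : R.jLower.essImage B) : f = 0 := by
  obtain ⟨Y, ⟨eA⟩⟩ := hA
  obtain ⟨D, ⟨eB⟩⟩ := hB
  have : eA.hom ≫ f ≫ eB.inv = 0 :=
    (R.adj₄.homEquiv _ _).symm.injective ((R.vanish Y).eq_of_src _ _)
  simpa using eA.inv ≫= (this =≫ eB.hom)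

lemma eq_zero_of_unit_comp {X B : T₂} (hB : R.iIncl.essImage B)
    (h : R.iIncl.obj (R.iStar.obj X) ⟶ B) (hh : R.adj₁.unit.app X ≫ h = 0) : h = 0 := by
  obtain ⟨Y, ⟨e⟩⟩ := hB
  obtain ⟨φ, hφ⟩ := R.iIncl.map_surjective (h ≫ e.inv)
  obtain ⟨ψ, hψ⟩ := R.iIncl.map_surjective (0 : R.iIncl.obj (R.iStar.obj X) ⟶ R.iIncl.obj Y)
  have : φ = ψ := (R.adj₁.homEquiv _ _).injective (by
    simp [Adjunction.homEquiv_unit, hφ, hψ, reassoc_of% hh])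
  subst this
  simpa using (hφ.symm.trans hψ) =≫ e.hom

lemma exists_triangle_jShriek_iIncl (X : T₂) :
    ∃ (A B : T₂) (a : A ⟶ X) (b : X ⟶ B) (δ : B ⟶ A⟦(1 : ℤ)⟧),
      Triangle.mk a b δ ∈ distTriang T₂ ∧ R.jShriek.essImage A ∧ R.iIncl.essImage B ∧
      (∀ (A' : T₂) (g : A' ⟶ A), R.jShriek.essImage A' → g ≫ a = 0 → g = 0) ∧
      (∀ (B' : T₂) (h : B ⟶ B'), R.iIncl.essImage B' → b ≫ h = 0 → h = 0) := by
  obtain ⟨δ, hδ⟩ := R.tri₂ X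
  refine ⟨_, _, _, _, δ, hδ, R.jShriek.obj_mem_essImage _, R.iIncl.obj_mem_essImage _, ?_,
    fun _ h hB' hh => R.eq_zero_of_unit_comp hB' h hh⟩
  rintro A' g ⟨D, ⟨e⟩⟩ hg
  obtain ⟨φ, hφ⟩ := R.jShriek.map_surjective (e.hom ≫ g)
  obtain ⟨ψ, hψ⟩ := R.jShriek.map_surjective (0 : R.jShriek.obj D ⟶ R.jShriek.obj (R.jStar.obj X))
  have : φ = ψ := (R.adj₃.homEquiv _ _).symm.injective (by
    simp [Adjunction.homEquiv_counit, hφ, hψ, hg])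
  subst this
  simpa using e.inv ≫= (hφ.symm.trans hψ)

lemma exists_triangle_iIncl_jLower (X : T₂) :
    ∃ (B C : T₂) (b : B ⟶ X) (c : X ⟶ C) (δ : C ⟶ B⟦(1 : ℤ)⟧),
      Triangle.mk b c δ ∈ distTriang T₂ ∧ R.iIncl.essImage B ∧ R.jLower.essImage C ∧
      (∀ (C' : T₂) (h : C ⟶ C'), R.jLower.essImage C' → c ≫ h = 0 → h = 0) := by
  obtain ⟨δ, hδ⟩ := R.tri₁ X
  refine ⟨_, _, _, _, δ, hδ, R.iIncl.obj_mem_essImage _, R.jLower.obj_mem_essImage _, ?_⟩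
  rintro C' h ⟨Y, ⟨e⟩⟩ hh
  obtain ⟨φ, hφ⟩ := R.jLower.map_surjective (h ≫ e.inv)
  obtain ⟨ψ, hψ⟩ := R.jLower.map_surjective (0 : R.jLower.obj (R.jStar.obj X) ⟶ R.jLower.obj Y)
  have : φ = ψ := (R.adj₄.homEquiv _ _).injective (by
    simp [Adjunction.homEquiv_unit, hφ, hψ, reassoc_of% hh])
  subst this
  simpa using (hφ.symm.trans hψ) =≫ e.hom

lemma mem_iIncl_of_hom_jShriek {X : T₂}
    (h : ∀ (A : T₂) (f : A ⟶ X), R.jShriek.essImage A → f = 0) : R.iIncl.essImage X := by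
  obtain ⟨A, B, a, b, δ, hT, hA, hB, inj, -⟩ := R.exists_triangle_jShriek_iIncl X
  have hA0 : IsZero A := (IsZero.iff_id_eq_zero A).2
    (inj _ _ hA (by rw [h A a hA, comp_zero]))
  have : IsIso b := (Triangle.isZero₁_iff_isIso₂ _ hT).1 hA0
  exact Functor.essImage.ofIso (asIso b).symm hB

lemma mem_jShriek_of_hom_iIncl {X : T₂}
    (h : ∀ (B : T₂) (f : X ⟶ B), R.iIncl.essImage B → f = 0) : R.jShriek.essImage X := by
  obtain ⟨A, B, a, b, δ, hT, hA, hB, -, inj⟩ := R.exists_triangle_jShriek_iIncl X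
  have hB0 : IsZero B := (IsZero.iff_id_eq_zero B).2
    (inj _ _ hB (by rw [h B b hB, zero_comp]))
  have : IsIso a := (Triangle.isZero₃_iff_isIso₁ _ hT).1 hB0
  exact Functor.essImage.ofIso (asIso a) hA

lemma mem_iIncl_of_hom_jLower {X : T₂}
    (h : ∀ (C : T₂) (f : X ⟶ C), R.jLower.essImage C → f = 0) : R.iIncl.essImage X := by
  obtain ⟨B, C, b, c, δ, hT, hB, hC, inj⟩ := R.exists_triangle_iIncl_jLower X
  have hC0 : IsZero C := (IsZero.iff_id_eq_zero C).2
    (inj _ _ hC (by rw [h C c hC, zero_comp]))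
  have : IsIso b := (Triangle.isZero₃_iff_isIso₁ _ hT).1 hC0
  exact Functor.essImage.ofIso (asIso b) hB

/-- `X` is a retract, compatibly, of an object of `j_!(T₃)` and an object of `i_*(T₁)`. -/
def Decomposes (X : T₂) : Prop :=
  ∃ (A B : T₂) (_ : R.jShriek.essImage A) (_ : R.iIncl.essImage B)
    (p : X ⟶ A) (i : A ⟶ X) (q : X ⟶ B) (j : B ⟶ X), p ≫ i + q ≫ j = 𝟙 X

variable {R}

lemma decomposes_of_retraction {X A B : T₂} {a : A ⟶ X} {b : X ⟶ B} {δ : B ⟶ A⟦(1 : ℤ)⟧}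
    (hT : Triangle.mk a b δ ∈ distTriang T₂) (hA : R.jShriek.essImage A)
    (hB : R.iIncl.essImage B) (r : X ⟶ A) (hr : a ≫ r = 𝟙 A) : R.Decomposes X := by
  obtain ⟨s, hs⟩ := exists_desc_of_distTriang hT (𝟙 X - r ≫ a)
    (by simp [Preadditive.comp_sub, reassoc_of% hr])
  exact ⟨A, B, hA, hB, r, a, b, s, by rw [← hs]; abel⟩

lemma decomposes_of_section {X A B : T₂} {a : A ⟶ X} {b : X ⟶ B} {δ : B ⟶ A⟦(1 : ℤ)⟧}
    (hT : Triangle.mk a b δ ∈ distTriang T₂) (hA : R.jShriek.essImage A)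
    (hB : R.iIncl.essImage B) (s : B ⟶ X) (hs : s ≫ b = 𝟙 B) : R.Decomposes X := by
  obtain ⟨t, ht⟩ := exists_lift_of_distTriang hT (𝟙 X - b ≫ s)
    (by simp [Preadditive.sub_comp, hs])
  exact ⟨A, B, hA, hB, t, a, b, s, by rw [← ht]; abel⟩

lemma Decomposes.eq_zero_of_comp {X Y : T₂} (hY : R.Decomposes Y) (f : X ⟶ Y)
    (h₁ : ∀ (A : T₂) (p : Y ⟶ A), R.jShriek.essImage A → f ≫ p = 0)
    (h₂ : ∀ (B : T₂) (q : Y ⟶ B), R.iIncl.essImage B → f ≫ q = 0) : f = 0 := by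
  obtain ⟨A, B, hA, hB, p, i, q, j, e⟩ := hY
  rw [← Category.comp_id f, ← e, Preadditive.comp_add, reassoc_of% h₁ A p hA,
    reassoc_of% h₂ B q hB, zero_comp, zero_comp, add_zero]

variable (R)

lemma decomposes_of_shift_neg_one_mem_iIncl (X : T₂) (hX : R.iIncl.essImage (X⟦(-1 : ℤ)⟧)) :
    R.Decomposes X := by
  obtain ⟨A, B, a, b, δ, hT, hA, hB, injA, injB⟩ := R.exists_triangle_jShriek_iIncl X
  obtain ⟨n, e₁, hT'⟩ := exists_invRotate hT
  obtain ⟨m, e₂, hT''⟩ := exists_invRotate hT'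
  have hna : n ≫ a = 0 := comp_distTriang_mor_zero₁₂ _ hT'
  have hmn : m ≫ n = 0 := comp_distTriang_mor_zero₁₂ _ hT''
  have hE : R.iIncl.essImage (B⟦(-1 : ℤ)⟧) := by
    refine R.mem_iIncl_of_hom_jShriek fun A' g hA' => ?_
    have h0 : g ≫ n = 0 := injA _ _ hA' (by rw [Category.assoc, hna, comp_zero])
    obtain ⟨k, hk⟩ := exists_lift_of_distTriang hT'' g h0
    rw [hk, R.hom_jShriek_iIncl k hA' hX, zero_comp]
  obtain ⟨s, hs⟩ := R.iIncl.exists_section_of_epi_in_essImage hX hE m (fun W g hW hg => by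
    obtain ⟨k, hk⟩ := exists_desc_of_distTriang hT'' g hg
    rw [hk, R.hom_jShriek_iIncl k hA hW, comp_zero])
  have hn0 : n = 0 := by rw [← Category.id_comp n, ← hs, Category.assoc, hmn, comp_zero]
  obtain ⟨r, hr⟩ := exists_desc_of_distTriang hT' (𝟙 A) (by rw [hn0, zero_comp])
  exact decomposes_of_retraction hT hA hB r hr.symm

lemma decomposes_of_shift_one_mem_iIncl (X : T₂) (hX : R.iIncl.essImage (X⟦(1 : ℤ)⟧)) :
    R.Decomposes X := by
  obtain ⟨B, C, b, c, δ, hT, hB, hC, injC⟩ := R.exists_triangle_iIncl_jLower X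
  obtain ⟨m, hT'⟩ := exists_rotate hT
  obtain ⟨m₂, hT''⟩ := exists_rotate hT'
  have hcδ : c ≫ δ = 0 := comp_distTriang_mor_zero₁₂ _ hT'
  have hδm : δ ≫ m = 0 := comp_distTriang_mor_zero₁₂ _ hT''
  have hB' : R.iIncl.essImage (B⟦(1 : ℤ)⟧) := by
    refine R.mem_iIncl_of_hom_jLower fun C' g hC' => ?_
    have h0 : δ ≫ g = 0 := injC _ _ hC' (by rw [reassoc_of% hcδ, zero_comp])
    obtain ⟨k, hk⟩ := exists_desc_of_distTriang hT'' g h0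
    rw [hk, R.hom_iIncl_jLower k hX hC', comp_zero]
  obtain ⟨r, hr⟩ := R.iIncl.exists_retraction_of_mono_in_essImage hB' hX m (fun W g hW hg => by
    obtain ⟨k, hk⟩ := exists_lift_of_distTriang hT'' g hg
    rw [hk, R.hom_iIncl_jLower k hW hC, zero_comp])
  have hδ0 : δ = 0 := by rw [← Category.comp_id δ, ← hr, reassoc_of% hδm, zero_comp]
  obtain ⟨s, hs⟩ : ∃ s : C ⟶ X, 𝟙 C = s ≫ c :=
    exists_lift_of_distTriang hT' (𝟙 C) (by rw [hδ0, comp_zero])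
  have hC1 : R.iIncl.essImage (C⟦(1 : ℤ)⟧) := by
    refine R.mem_iIncl_of_hom_jShriek fun A' g hA' => ?_
    rw [← Category.comp_id g, ← (shiftFunctor T₂ (1 : ℤ)).map_id, hs, Functor.map_comp,
      ← Category.assoc, R.hom_jShriek_iIncl (g ≫ s⟦(1 : ℤ)⟧') hA' hX, zero_comp]
  have hCP : R.jShriek.essImage C := by
    refine R.mem_jShriek_of_hom_iIncl fun W f hW => ?_
    obtain ⟨E, e, d, hE⟩ := distinguished_cocone_triangle f
    obtain ⟨d', hE'⟩ := exists_rotate hE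
    have hfe : f ≫ e = 0 := comp_distTriang_mor_zero₁₂ _ hE
    have hEI : R.iIncl.essImage E := by
      refine R.mem_iIncl_of_hom_jShriek fun A' g hA' => ?_
      obtain ⟨k, hk⟩ := exists_lift_of_distTriang hE' g (R.hom_jShriek_iIncl _ hA' hC1)
      rw [hk, R.hom_jShriek_iIncl k hA' hW, zero_comp]
    obtain ⟨r, hr⟩ := R.iIncl.exists_retraction_of_mono_in_essImage hW hEI e (fun V g hV hg => by
      obtain ⟨k, hk⟩ := exists_lift_of_distTriang hE g hg
      rw [hk, R.hom_iIncl_jLower k hV hC, zero_comp])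
    rw [← Category.comp_id f, ← hr, reassoc_of% hfe, zero_comp]
  obtain ⟨t, ht⟩ := exists_lift_of_distTriang hT (𝟙 X - c ≫ s)
    (by simp [Preadditive.sub_comp, ← hs])
  exact ⟨C, B, hCP, hB, c, s, t, b, by rw [← ht]; abel⟩

lemma decomposes_of_shift_one_mem_jShriek (X : T₂) (hX : R.jShriek.essImage (X⟦(1 : ℤ)⟧)) :
    R.Decomposes X := by
  obtain ⟨A, B, a, b, δ, hT, hA, hB, injA, injB⟩ := R.exists_triangle_jShriek_iIncl X
  obtain ⟨m, hT'⟩ := exists_rotate hT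
  obtain ⟨m₂, hT''⟩ := exists_rotate hT'
  have hbδ : b ≫ δ = 0 := comp_distTriang_mor_zero₁₂ _ hT'
  have hδm : δ ≫ m = 0 := comp_distTriang_mor_zero₁₂ _ hT''
  have hA' : R.jShriek.essImage (A⟦(1 : ℤ)⟧) := by
    refine R.mem_jShriek_of_hom_iIncl fun W g hW => ?_
    have h0 : δ ≫ g = 0 := injB _ _ hW (by rw [reassoc_of% hbδ, zero_comp])
    obtain ⟨k, hk⟩ := exists_desc_of_distTriang hT'' g h0
    rw [hk, R.hom_jShriek_iIncl k hX hW, comp_zero]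
  obtain ⟨r, hr⟩ := R.jShriek.exists_retraction_of_mono_in_essImage hA' hX m
    (fun W g hW hg => by
      obtain ⟨k, hk⟩ := exists_lift_of_distTriang hT'' g hg
      rw [hk, R.hom_jShriek_iIncl k hW hB, zero_comp])
  have hδ0 : δ = 0 := by rw [← Category.comp_id δ, ← hr, reassoc_of% hδm, zero_comp]
  obtain ⟨s, hs⟩ : ∃ s : B ⟶ X, 𝟙 B = s ≫ b :=
    exists_lift_of_distTriang hT' (𝟙 B) (by rw [hδ0, comp_zero])
  exact decomposes_of_section hT hA hB s hs.symm

lemma decomposes_of_shift_neg_one_mem_jShriek (X : T₂)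
    (hX : R.jShriek.essImage (X⟦(-1 : ℤ)⟧)) : R.Decomposes X := by
  obtain ⟨A, B, a, b, δ, hT, hA, hB, injA, injB⟩ := R.exists_triangle_jShriek_iIncl X
  obtain ⟨n, e₁, hT'⟩ := exists_invRotate hT
  obtain ⟨m, e₂, hT''⟩ := exists_invRotate hT'
  have hna : n ≫ a = 0 := comp_distTriang_mor_zero₁₂ _ hT'
  have hE : R.Decomposes (B⟦(-1 : ℤ)⟧) := R.decomposes_of_shift_one_mem_iIncl _
    (Functor.essImage.ofIso (shiftNegShift B (1 : ℤ)).symm hB)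
  have hn0 : n = 0 := by
    obtain ⟨A', B', hA', hB', p, i, q, j, e⟩ := hE
    have hi : i ≫ n = 0 := injA _ _ hA' (by rw [Category.assoc, hna, comp_zero])
    obtain ⟨k, hk⟩ := exists_desc_of_distTriang hT'' q (R.hom_jShriek_iIncl _ hX hB')
    have hq : q = 0 := by rw [hk, R.hom_jShriek_iIncl k hA hB', comp_zero]
    rw [← Category.id_comp n, ← e, hq]
    simp [hi]
  obtain ⟨r, hr⟩ := exists_desc_of_distTriang hT' (𝟙 A) (by rw [hn0, zero_comp])
  exact decomposes_of_retraction hT hA hB r hr.symm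

lemma decomposes_shift_one (X : T₂) (hX : R.jShriek.essImage X ∨ R.iIncl.essImage X) :
    R.Decomposes (X⟦(1 : ℤ)⟧) := by
  rcases hX with hX | hX
  · exact R.decomposes_of_shift_neg_one_mem_jShriek _
      (Functor.essImage.ofIso (shiftShiftNeg X (1 : ℤ)).symm hX)
  · exact R.decomposes_of_shift_neg_one_mem_iIncl _
      (Functor.essImage.ofIso (shiftShiftNeg X (1 : ℤ)).symm hX)

lemma decomposes_shift_neg_one (X : T₂) (hX : R.jShriek.essImage X ∨ R.iIncl.essImage X) :
    R.Decomposes (X⟦(-1 : ℤ)⟧) := by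
  rcases hX with hX | hX
  · exact R.decomposes_of_shift_one_mem_jShriek _
      (Functor.essImage.ofIso (shiftNegShift X (1 : ℤ)).symm hX)
  · exact R.decomposes_of_shift_one_mem_iIncl _
      (Functor.essImage.ofIso (shiftNegShift X (1 : ℤ)).symm hX)

/-- If every morphism from `K` to `j_!(T₃)` vanishes and every morphism from `K` to `i_*(T₁)`
extends uniquely along `K ⟶ Z`, then the cone of `K ⟶ Z` is a reflection of `Z` in `j_!(T₃)`. -/
lemma cone_reflection {K Z C : T₂} {k : K ⟶ Z} {c : Z ⟶ C} {δ : C ⟶ K⟦(1 : ℤ)⟧}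
    (hT : Triangle.mk k c δ ∈ distTriang T₂)
    (hK : ∀ (A : T₂) (f : K ⟶ A), R.jShriek.essImage A → f = 0)
    (ext : ∀ (B : T₂) (f : K ⟶ B), R.iIncl.essImage B → ∃ g : Z ⟶ B, f = k ≫ g)
    (uniq : ∀ (B : T₂) (g : Z ⟶ B), R.iIncl.essImage B → k ≫ g = 0 → g = 0) :
    R.jShriek.essImage C ∧
      ∀ (A : T₂) (f : C ⟶ A), R.jShriek.essImage A → c ≫ f = 0 → f = 0 := by
  have hkc : k ≫ c = 0 := comp_distTriang_mor_zero₁₂ _ hT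
  have hδk : δ ≫ k⟦(1 : ℤ)⟧' = 0 := comp_distTriang_mor_zero₃₁ _ hT
  have key : ∀ (V : T₂) (f : C ⟶ V), (R.jShriek.essImage V ∨ R.iIncl.essImage V) →
      c ≫ f = 0 → f = 0 := by
    intro V f hV hf
    obtain ⟨f, rfl⟩ : ∃ f' : K⟦(1 : ℤ)⟧ ⟶ V, f = δ ≫ f' := Triangle.yoneda_exact₃ _ hT f hf
    obtain ⟨A, B, hA, hB, p, i, q, j, e⟩ := R.decomposes_shift_neg_one V hV
    let f' : K ⟶ V⟦(-1 : ℤ)⟧ := (shiftShiftNeg K (1 : ℤ)).inv ≫ f⟦(-1 : ℤ)⟧'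
    obtain ⟨g, hg⟩ := ext B (f' ≫ q) hB
    have hf' : f' = k ≫ g ≫ j := by
      rw [← Category.comp_id f', ← e, Preadditive.comp_add, ← Category.assoc f' p,
        hK A (f' ≫ p) hA, zero_comp, zero_add, ← Category.assoc f' q, hg, Category.assoc]
    have h1 : f⟦(-1 : ℤ)⟧' = (shiftShiftNeg K (1 : ℤ)).hom ≫ k ≫ g ≫ j := by
      rw [← hf']; exact (Iso.hom_inv_id_assoc _ _).symm
    have h2 : (shiftShiftNeg K (1 : ℤ)).hom ≫ k =
        k⟦(1 : ℤ)⟧'⟦(-1 : ℤ)⟧' ≫ (shiftShiftNeg Z (1 : ℤ)).hom :=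
      ((shiftFunctorCompIsoId T₂ (1 : ℤ) (-1) (by simp)).hom.naturality k).symm
    apply (shiftFunctor T₂ (-1 : ℤ)).map_injective
    rw [Functor.map_comp, h1, reassoc_of% h2, ← Functor.map_comp_assoc, hδk]
    simp
  refine ⟨R.mem_jShriek_of_hom_iIncl fun B f hB => key B f (Or.inr hB) ?_,
    fun A f hA hf => key A f (Or.inl hA) hf⟩
  exact uniq _ _ hB (by rw [reassoc_of% hkc, zero_comp])

lemma iStar_jShriek_isZero (Y : T₃) : IsZero (R.iStar.obj (R.jShriek.obj Y)) := by
  rw [IsZero.iff_id_eq_zero]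
  apply (R.adj₁.homEquiv _ _).injective
  rw [R.hom_jShriek_iIncl (R.adj₁.homEquiv _ _ (𝟙 _)) (R.jShriek.obj_mem_essImage _)
      (R.iIncl.obj_mem_essImage _),
    R.hom_jShriek_iIncl (R.adj₁.homEquiv _ _ 0) (R.jShriek.obj_mem_essImage _)
      (R.iIncl.obj_mem_essImage _)]

section LeftAdjointOfIStar

variable {F : T₁ ⥤ T₂}

lemma hom_leftAdjoint_jShriek (adj : F ⊣ R.iStar) {A B : T₂} (f : A ⟶ B)
    (hA : F.essImage A) (hB : R.jShriek.essImage B) : f = 0 := by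
  obtain ⟨W, ⟨eA⟩⟩ := hA
  obtain ⟨D, ⟨eB⟩⟩ := hB
  have : eA.hom ≫ f ≫ eB.inv = 0 :=
    (adj.homEquiv _ _).injective ((R.iStar_jShriek_isZero D).eq_of_tgt _ _)
  simpa using eA.inv ≫= (this =≫ eB.hom)

lemma homEquiv_counit_comp (adj : F ⊣ R.iStar) {Z : T₂} {V : T₁} (g : Z ⟶ R.iIncl.obj V) :
    adj.homEquiv _ _ (adj.counit.app Z ≫ g) ≫ R.adj₁.counit.app V =
      (R.adj₁.homEquiv _ _).symm g := by
  simp [Adjunction.homEquiv_unit, Adjunction.homEquiv_counit]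

lemma exists_extension_along_counit (adj : F ⊣ R.iStar) {Z B : T₂}
    (hB : R.iIncl.essImage B) (f : F.obj (R.iStar.obj Z) ⟶ B) :
    ∃ g : Z ⟶ B, f = adj.counit.app Z ≫ g := by
  obtain ⟨V, ⟨e⟩⟩ := hB
  let g : Z ⟶ R.iIncl.obj V :=
    R.adj₁.homEquiv Z V (adj.homEquiv _ _ (f ≫ e.inv) ≫ R.adj₁.counit.app V)
  have : f ≫ e.inv = adj.counit.app Z ≫ g := by
    apply (adj.homEquiv _ _).injective
    rw [← cancel_mono (R.adj₁.counit.app V), R.homEquiv_counit_comp adj]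
    exact ((R.adj₁.homEquiv Z V).symm_apply_apply _).symm
  exact ⟨g ≫ e.hom, by simpa using this =≫ e.hom⟩

lemma eq_zero_of_counit_comp (adj : F ⊣ R.iStar) {Z B : T₂}
    (hB : R.iIncl.essImage B) (g : Z ⟶ B)
    (hg : adj.counit.app Z ≫ g = 0) : g = 0 := by
  obtain ⟨V, ⟨e⟩⟩ := hB
  have : g ≫ e.inv = 0 := (R.adj₁.homEquiv _ _).symm.injective (by
    rw [← R.homEquiv_counit_comp adj, ← R.homEquiv_counit_comp adj, reassoc_of% hg]
    simp)
  simpa using this =≫ e.hom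

lemma cone_counit_reflection (adj : F ⊣ R.iStar) {Z C : T₂} {c : Z ⟶ C}
    {δ : C ⟶ (F.obj (R.iStar.obj Z))⟦(1 : ℤ)⟧}
    (hT : Triangle.mk (adj.counit.app Z) c δ ∈ distTriang T₂) :
    R.jShriek.essImage C ∧
      ∀ (A : T₂) (f : C ⟶ A), R.jShriek.essImage A → c ≫ f = 0 → f = 0 :=
  R.cone_reflection hT
    (fun _ f hA => R.hom_leftAdjoint_jShriek adj f (F.obj_mem_essImage _) hA)
    (fun _ f hB => R.exists_extension_along_counit adj hB f)
    (fun _ g hB hg => R.eq_zero_of_counit_comp adj hB g hg)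

lemma exists_leftAdjoint_jShriek (adj : F ⊣ R.iStar) :
    ∃ G : T₂ ⥤ T₃, Nonempty (G ⊣ R.jShriek) := by
  refine R.jShriek.exists_leftAdjoint_of_universal_arrows fun Z => ?_
  obtain ⟨C, c, δ, hT⟩ := distinguished_cocone_triangle (adj.counit.app Z)
  obtain ⟨⟨D, ⟨e⟩⟩, uniq⟩ := R.cone_counit_reflection adj hT
  refine ⟨D, c ≫ e.inv, fun Y => ⟨fun f f' hff' => R.jShriek.map_injective ?_, fun g => ?_⟩⟩
  · have := uniq _ (e.inv ≫ (R.jShriek.map f - R.jShriek.map f')) (R.jShriek.obj_mem_essImage _)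
      (by simpa [Preadditive.comp_sub, sub_eq_zero] using hff')
    rwa [← cancel_epi e.inv, ← sub_eq_zero, ← Preadditive.comp_sub]
  · obtain ⟨g', rfl⟩ := exists_desc_of_distTriang hT g
      (R.hom_leftAdjoint_jShriek adj _ (F.obj_mem_essImage _) (R.jShriek.obj_mem_essImage _))
    obtain ⟨f, hf⟩ := R.jShriek.map_surjective (e.hom ≫ g')
    exact ⟨f, by simp [hf]⟩

lemma ttfTriple_of_leftAdjoint (adj : F ⊣ R.iStar) :
    TTFTriple F.essImage R.jShriek.essImage R.iIncl.essImage := by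
  refine ⟨⟨fun A B f hA hB => R.hom_leftAdjoint_jShriek adj f hA hB, fun Z => ?_⟩,
    fun A B f hA hB => R.hom_jShriek_iIncl f hA hB, fun Z => ?_⟩
  · obtain ⟨C, c, δ, hT⟩ := distinguished_cocone_triangle (adj.counit.app Z)
    exact ⟨_, C, F.obj_mem_essImage _, (R.cone_counit_reflection adj hT).1, _, c, δ, hT⟩
  · obtain ⟨δ, hδ⟩ := R.tri₂ Z
    exact ⟨_, _, R.jShriek.obj_mem_essImage _, R.iIncl.obj_mem_essImage _, _, _, δ, hδ⟩

end LeftAdjointOfIStar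

/-- If `u : Z ⟶ A` is a reflection of `Z` in `j_!(T₃)` with fibre `K`, then `K` is left orthogonal
to `j_!(T₃)` and morphisms from `K` to `i_*(T₁)` extend to `Z`. -/
lemma fibre_of_reflection {K Z A : T₂} {k : K ⟶ Z} {u : Z ⟶ A} {δ : A ⟶ K⟦(1 : ℤ)⟧}
    (hT : Triangle.mk k u δ ∈ distTriang T₂) (hA : R.jShriek.essImage A)
    (ext : ∀ (A' : T₂) (f : Z ⟶ A'), R.jShriek.essImage A' → ∃ g : A ⟶ A', f = u ≫ g)
    (uniq : ∀ (A' : T₂) (g : A ⟶ A'), R.jShriek.essImage A' → u ≫ g = 0 → g = 0) :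
    (∀ (A' : T₂) (f : K ⟶ A'), R.jShriek.essImage A' → f = 0) ∧
      ∀ (B : T₂) (f : K ⟶ B), R.iIncl.essImage B → ∃ g : Z ⟶ B, f = k ≫ g := by
  have hku : k ≫ u = 0 := comp_distTriang_mor_zero₁₂ _ hT
  have huδ : u ≫ δ = 0 := comp_distTriang_mor_zero₂₃ _ hT
  have key : ∀ (V : T₂) (f : K ⟶ V), (R.jShriek.essImage V ∨ R.iIncl.essImage V) →
      ∃ g : Z ⟶ V, f = k ≫ g := fun V f hV =>
    exists_extension_of_distTriang hT f <| (R.decomposes_shift_one V hV).eq_zero_of_comp _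
      (fun A' p hA' => uniq _ _ hA' (by rw [Category.assoc, reassoc_of% huδ, zero_comp]))
      (fun B q hB => R.hom_jShriek_iIncl _ hA hB)
  refine ⟨fun A' f hA' => ?_, fun B f hB => key B f (Or.inr hB)⟩
  obtain ⟨g, rfl⟩ := key A' f (Or.inl hA')
  obtain ⟨g, rfl⟩ := ext A' g hA'
  rw [reassoc_of% hku, zero_comp]

lemma comp_unit_bijective {K : T₂}
    (hK : ∀ (A : T₂) (f : K ⟶ A), R.jShriek.essImage A → f = 0) (X : T₂) :
    Function.Bijective (fun f : K ⟶ X => f ≫ R.adj₁.unit.app X) := by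
  obtain ⟨δ, hT⟩ := R.tri₂ X
  have hδ : R.adj₁.unit.app X ≫ δ = 0 := comp_distTriang_mor_zero₂₃ _ hT
  refine ⟨fun f f' hff' => ?_, fun f => ?_⟩
  · obtain ⟨g, hg⟩ := exists_lift_of_distTriang hT (f - f')
      (by simpa only [Preadditive.sub_comp, sub_eq_zero] using hff')
    rw [hK _ g (R.jShriek.obj_mem_essImage _), zero_comp] at hg
    exact sub_eq_zero.1 hg
  · obtain ⟨m, hT'⟩ := exists_rotate hT
    have hD := R.decomposes_shift_one (R.jShriek.obj (R.jStar.obj X))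
      (Or.inl (R.jShriek.obj_mem_essImage _))
    obtain ⟨g, hg⟩ := exists_lift_of_distTriang hT' f <| hD.eq_zero_of_comp _
      (fun A p hA => hK _ _ hA)
      (fun B q hB => by
        rw [Category.assoc, R.eq_zero_of_unit_comp hB (δ ≫ q) (by rw [reassoc_of% hδ, zero_comp]),
          comp_zero])
    exact ⟨g, hg.symm⟩

lemma exists_leftAdjoint_iStar {G : T₂ ⥤ T₃} (adj : G ⊣ R.jShriek) :
    ∃ F : T₁ ⥤ T₂, Nonempty (F ⊣ R.iStar) := by
  refine R.iStar.exists_leftAdjoint_of_universal_arrows fun W => ?_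
  obtain ⟨K, k, δ, hT⟩ := distinguished_cocone_triangle₁ (adj.unit.app (R.iIncl.obj W))
  obtain ⟨hK, ext⟩ := R.fibre_of_reflection hT (R.jShriek.obj_mem_essImage _)
    (fun A' f hA' => by
      obtain ⟨D, ⟨e⟩⟩ := hA'
      refine ⟨R.jShriek.map ((adj.homEquiv _ _).symm (f ≫ e.inv)) ≫ e.hom, ?_⟩
      have := (adj.homEquiv _ _).apply_symm_apply (f ≫ e.inv)
      rw [Adjunction.homEquiv_unit] at this
      simpa using (this =≫ e.hom).symm)
    (fun A' g hA' hg => by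
      obtain ⟨D, ⟨e⟩⟩ := hA'
      obtain ⟨φ, hφ⟩ := R.jShriek.map_surjective (g ≫ e.inv)
      obtain ⟨ψ, hψ⟩ := R.jShriek.map_surjective
        (0 : R.jShriek.obj (G.obj (R.iIncl.obj W)) ⟶ R.jShriek.obj D)
      have : φ = ψ := (adj.homEquiv _ _).injective (by
        rw [Adjunction.homEquiv_unit, Adjunction.homEquiv_unit, hφ, hψ, reassoc_of% hg]
        simp)
      subst this
      simpa using (hφ.symm.trans hψ) =≫ e.hom)
  have uniq : ∀ (V : T₁) (g g' : R.iIncl.obj W ⟶ R.iIncl.obj V), k ≫ g = k ≫ g' → g = g' := by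
    intro V g g' hgg'
    obtain ⟨h, hh⟩ := exists_desc_of_distTriang hT (g - g')
      (by rw [Preadditive.comp_sub, sub_eq_zero, hgg'])
    rw [R.hom_jShriek_iIncl h (R.jShriek.obj_mem_essImage _) (R.iIncl.obj_mem_essImage _),
      comp_zero] at hh
    exact sub_eq_zero.1 hh
  obtain ⟨η, hη⟩ := ext _ (R.adj₁.unit.app K) (R.iIncl.obj_mem_essImage _)
  obtain ⟨η, rfl⟩ := R.iIncl.map_surjective η
  have hη' : ∀ {Y : T₂} (f : K ⟶ Y),
      k ≫ R.iIncl.map (η ≫ R.iStar.map f) = f ≫ R.adj₁.unit.app Y := fun f => by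
    rw [Functor.map_comp, ← Category.assoc, ← hη]
    exact (R.adj₁.unit.naturality f).symm
  refine ⟨K, η, fun Y => ⟨fun f f' hff' => (R.comp_unit_bijective hK Y).1 ?_, fun h => ?_⟩⟩
  · dsimp only at hff' ⊢
    rw [← hη', ← hη', hff']
  · obtain ⟨f, hf⟩ := (R.comp_unit_bijective hK Y).2 (k ≫ R.iIncl.map h)
    exact ⟨f, R.iIncl.map_injective (uniq _ _ _ ((hη' f).trans hf))⟩

end Recollement

/-- Let `(T₁ ← T₂ → T₃)` be a recollement with functors
`(i^*, i_*, i^!)` and `(j_!, j^*, j_*)`.  Then `i^*` admits a left adjoint iff `j_!`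
admits a left adjoint; moreover, for any left adjoint `F` of `i^*`, `F` is fully
faithful and `(F(T₁), j_!(T₃), i_*(T₁))` is a TTF triple of `T₂`. -/
theorem recollement_left_adjoints {T₁ : Type u₁} [Category.{v₁} T₁] [Preadditive T₁]
    [HasZeroObject T₁] [HasShift T₁ ℤ] [∀ n : ℤ, (shiftFunctor T₁ n).Additive]
    [Pretriangulated T₁]
    {T₂ : Type u₂} [Category.{v₂} T₂] [Preadditive T₂] [HasZeroObject T₂]
    [HasShift T₂ ℤ] [∀ n : ℤ, (shiftFunctor T₂ n).Additive] [Pretriangulated T₂]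
    {T₃ : Type u₃} [Category.{v₃} T₃] [Preadditive T₃] [HasZeroObject T₃]
    [HasShift T₃ ℤ] [∀ n : ℤ, (shiftFunctor T₃ n).Additive] [Pretriangulated T₃]
    (R : Recollement T₁ T₂ T₃) :
    ((∃ F : T₁ ⥤ T₂, Nonempty (F ⊣ R.iStar)) ↔
      (∃ F' : T₂ ⥤ T₃, Nonempty (F' ⊣ R.jShriek))) ∧
    (∀ (F : T₁ ⥤ T₂) (_ : F ⊣ R.iStar),
      F.Full ∧ F.Faithful ∧
        TTFTriple F.essImage R.jShriek.essImage R.iIncl.essImage) := by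
  have ff : ∀ F : T₁ ⥤ T₂, (F ⊣ R.iStar) → F.FullyFaithful := fun F adj =>
    (Adjunction.Triple.mk adj R.adj₁).fullyFaithfulEquiv.symm (.ofFullyFaithful R.iIncl)
  exact ⟨⟨fun ⟨_, ⟨adj⟩⟩ => R.exists_leftAdjoint_jShriek adj,
      fun ⟨_, ⟨adj⟩⟩ => R.exists_leftAdjoint_iStar adj⟩,
    fun F adj => ⟨(ff F adj).full, (ff F adj).faithful, R.ttfTriple_of_leftAdjoint adj⟩⟩
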